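/- Let n ≥ 3 and let S_n be the monoid presented by generators a_1, …, a_n and relations a_1 a_2 ⋯ a_n = a_{σ(1)} ⋯ a_{σ(n)} for σ in the cyclic group generated by the n-cycle. Then S_n is a unique product monoid: for any two nonempty finite subsets A, B of S_n, there exists an element of the product set A·B that can be written uniquely as a·b with a ∈ A and b ∈ B. -/

import Mathlib

/-- The word `a_{σ(1)} a_{σ(2)} ⋯ a_{σ(n)}` in the free monoid on `n` generators. -/
def permWord (n : ℕ) (σ : Equiv.Perm (Fin n)) : FreeMonoid (Fin n) :=
  ((List.finRange n).map fun i => FreeMonoid.of (σ i)).prod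

/-- The defining relations `a_1 a_2 ⋯ a_n = a_{σ(1)} a_{σ(2)} ⋯ a_{σ(n)}`, where `σ` runs
through the cyclic subgroup of `Sym_n` generated by the `n`-cycle `(1,2,…,n)` (i.e. `finRotate n`). -/
def cycRel (n : ℕ) : FreeMonoid (Fin n) → FreeMonoid (Fin n) → Prop :=
  fun x y => x = permWord n 1 ∧ ∃ k : ℕ, y = permWord n (finRotate n ^ k)

/-- The monoid `S_n` presented by generators `a_1, …, a_n` and the above relations. -/
def Scyc (n : ℕ) : Type := (conGen (cycRel n)).Quotient

instance (n : ℕ) : Monoid (Scyc n) := Con.monoid _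

/-- The generator `a_i` of `S_n`. -/
def agen {n : ℕ} (i : Fin n) : Scyc n := (conGen (cycRel n)).mk' (FreeMonoid.of i)

/-- The element `z = a_1 a_2 ⋯ a_n` of `S_n`. -/
def zc (n : ℕ) : Scyc n := ((List.finRange n).map agen).prod

/-- A nontrivial subgroup of a free group, generated by `T`, carries an additive character that
does not vanish on all of `T`. -/
theorem IsFreeGroup.exists_character {G : Type*} [Group G] [IsFreeGroup G] (T : Set G)
    (hT : ∃ t ∈ T, t ≠ 1) :
    ∃ χ : G → ℤ, (∀ g ∈ Subgroup.closure T, ∀ h ∈ Subgroup.closure T, χ (g * h) = χ g + χ h) ∧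
      ∃ t ∈ T, χ t ≠ 0 := by
  classical
  obtain ⟨t, htT, ht1⟩ := hT
  set H := Subgroup.closure T with hH
  obtain ⟨x⟩ : Nonempty (IsFreeGroup.Generators H) := by
    by_contra hne
    rw [not_nonempty_iff] at hne
    have : Subsingleton H := (IsFreeGroup.toFreeGroup H).toEquiv.subsingleton
    exact ht1 (congrArg Subtype.val
      (Subsingleton.elim (⟨t, Subgroup.subset_closure htT⟩ : H) 1))
  let φ : H →* Multiplicative ℤ := IsFreeGroup.lift fun _ => Multiplicative.ofAdd 1
  have hφ : φ (IsFreeGroup.of x) = Multiplicative.ofAdd 1 := IsFreeGroup.lift_of _ _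
  refine ⟨fun g => if h : g ∈ H then (φ ⟨g, h⟩).toAdd else 0, fun g hg h hh => ?_, ?_⟩
  · simp only [hg, hh, H.mul_mem hg hh, dif_pos]
    rw [← toAdd_mul, ← map_mul]
    rfl
  · by_contra! hzero
    have h1 : φ = 1 := by
      refine MonoidHom.eq_of_eqOn_dense (Subgroup.closure_closure_coe_preimage (k := T)) ?_
      intro y hy
      have := hzero y hy
      rw [dif_pos y.2] at this
      exact Multiplicative.toAdd.injective this
    rw [h1] at hφ
    exact absurd (congrArg Multiplicative.toAdd hφ) (by simp)

/-- Free groups are unique product groups. -/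
theorem IsFreeGroup.uniqueProds (G : Type*) [Group G] [IsFreeGroup G] : UniqueProds G where
  uniqueMul_of_nonempty {A B} hA hB := by
    classical
    induction hN : A.card + B.card using Nat.strong_induction_on generalizing A B with
    | _ N ih =>
    by_cases hcard : A.card ≤ 1 ∧ B.card ≤ 1
    · obtain ⟨a, ha⟩ := hA
      obtain ⟨b, hb⟩ := hB
      refine ⟨a, ha, b, hb, fun a' b' ha' hb' _ => ⟨?_, ?_⟩⟩
      · exact Finset.card_le_one.1 hcard.1 _ ha' _ ha
      · exact Finset.card_le_one.1 hcard.2 _ hb' _ hb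
    obtain ⟨a₀, ha₀⟩ := hA
    obtain ⟨b₀, hb₀⟩ := hB
    obtain ⟨χ, hχ, t, ht, htχ⟩ := IsFreeGroup.exists_character
      ((fun a => a₀⁻¹ * a) '' (A : Set G) ∪ (fun b => b * b₀⁻¹) '' (B : Set G)) (by
        rw [not_and_or, not_le, not_le] at hcard
        rcases hcard with h | h
        · obtain ⟨a, ha, hne⟩ := Finset.exists_mem_ne h a₀
          exact ⟨_, Or.inl ⟨a, ha, rfl⟩, fun h => hne (inv_mul_eq_one.1 h).symm⟩
        · obtain ⟨b, hb, hne⟩ := Finset.exists_mem_ne h b₀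
          exact ⟨_, Or.inr ⟨b, hb, rfl⟩, fun h => hne (mul_inv_eq_one.1 h)⟩)
    have hadd : ∀ a ∈ A, ∀ b ∈ B, χ (a₀⁻¹ * (a * b) * b₀⁻¹) = χ (a₀⁻¹ * a) + χ (b * b₀⁻¹) := by
      intro a ha b hb
      rw [← hχ _ (Subgroup.subset_closure (Or.inl ⟨a, ha, rfl⟩)) _
        (Subgroup.subset_closure (Or.inr ⟨b, hb, rfl⟩))]
      simp only [mul_assoc]
    have hχ1 : χ 1 = 0 := by simpa using hχ 1 (one_mem _) 1 (one_mem _)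
    obtain ⟨aM, haM, hmaxA⟩ := A.exists_max_image (fun a => χ (a₀⁻¹ * a)) ⟨a₀, ha₀⟩
    obtain ⟨bM, hbM, hmaxB⟩ := B.exists_max_image (fun b => χ (b * b₀⁻¹)) ⟨b₀, hb₀⟩
    set A₁ := A.filter fun a => χ (a₀⁻¹ * a) = χ (a₀⁻¹ * aM) with hA₁
    set B₁ := B.filter fun b => χ (b * b₀⁻¹) = χ (bM * b₀⁻¹) with hB₁
    have hlt : A₁.card + B₁.card < N := by
      have hA₁le : A₁.card ≤ A.card := Finset.card_filter_le _ _
      have hB₁le : B₁.card ≤ B.card := Finset.card_filter_le _ _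
      by_contra! hge
      have hAe := Finset.card_filter_eq_iff.1 (show A₁.card = A.card by omega)
      have hBe := Finset.card_filter_eq_iff.1 (show B₁.card = B.card by omega)
      rcases ht with ⟨a, ha, rfl⟩ | ⟨b, hb, rfl⟩
      · apply htχ
        simp only
        rw [hAe a ha, ← hAe a₀ ha₀, inv_mul_cancel, hχ1]
      · apply htχ
        simp only
        rw [hBe b hb, ← hBe b₀ hb₀, mul_inv_cancel, hχ1]
    obtain ⟨a, ha, b, hb, hab⟩ := ih _ hlt (A := A₁) (B := B₁)
      ⟨aM, Finset.mem_filter.2 ⟨haM, rfl⟩⟩ ⟨bM, Finset.mem_filter.2 ⟨hbM, rfl⟩⟩ rfl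
    rw [hA₁, Finset.mem_filter] at ha
    rw [hB₁, Finset.mem_filter] at hb
    refine ⟨a, ha.1, b, hb.1, fun a' b' ha' hb' h => ?_⟩
    have hsum := hadd a' ha' b' hb'
    rw [h, hadd a ha.1 b hb.1] at hsum
    have h1 := hmaxA a' ha'
    have h2 := hmaxB b' hb'
    exact hab (Finset.mem_filter.2 ⟨ha', by linarith [ha.2, hb.2]⟩)
      (Finset.mem_filter.2 ⟨hb', by linarith [ha.2, hb.2]⟩) h

section Runs

variable {α : Type*} [DecidableEq α] (s : α → α)

/-- The length of the longest prefix of a word that has the form `i, s i, s (s i), …`. -/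
def runLength : α → List α → ℕ
  | _, [] => 0
  | i, x :: w => if x = i then runLength (s i) w + 1 else 0

/-- No factor of the word has the form `i, s i, …, s^[n - 1] i`. -/
def RunBounded (n : ℕ) : List α → Prop
  | [] => True
  | x :: w => runLength s (s x) w + 1 < n ∧ RunBounded n w

/-- Left multiplication by the letter `i` on pairs `(k, w)`, which stand for `z ^ k * w` where `z`
is central and equal to every word `i, s i, …, s^[n - 1] i`. -/
def push (n : ℕ) (i : α) (p : ℕ × List α) : ℕ × List α :=
  if runLength s (s i) p.2 + 1 < n then (p.1, i :: p.2) else (p.1 + 1, p.2.drop (n - 1))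

variable {s} {n : ℕ}

theorem RunBounded.runLength_lt (hn : 0 < n) {w : List α} (hw : RunBounded s n w) (j : α) :
    runLength s j w < n := by
  cases w with
  | nil => exact hn
  | cons x w =>
    simp only [runLength]
    split_ifs with h
    · exact h ▸ hw.1
    · exact hn

theorem RunBounded.drop {w : List α} (hw : RunBounded s n w) (k : ℕ) :
    RunBounded s n (w.drop k) := by
  induction k generalizing w with
  | zero => exact hw
  | succ k ih =>
    cases w with
    | nil => exact hw
    | cons x w => exact ih hw.2

theorem RunBounded.push {p : ℕ × List α} (hp : RunBounded s n p.2) (i : α) :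
    RunBounded s n (push s n i p).2 := by
  unfold _root_.push
  split_ifs with h
  · exact ⟨h, hp⟩
  · exact hp.drop _

theorem runLength_iterate_append (i : α) (t : ℕ) (w : List α) :
    runLength s i (List.iterate s i t ++ w) = t + runLength s (s^[t] i) w := by
  induction t generalizing i with
  | zero => simp
  | succ t ih => simp [List.iterate, runLength, ih]; omega

theorem exists_eq_iterate_append (j : α) (w : List α) :
    ∃ w', w = List.iterate s j (runLength s j w) ++ w' ∧
      runLength s (s^[runLength s j w] j) w' = 0 := by
  induction w generalizing j with
  | nil => exact ⟨[], rfl, rfl⟩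
  | cons x w ih =>
    by_cases h : x = j
    · obtain ⟨w', h1, h2⟩ := ih (s j)
      refine ⟨w', ?_, ?_⟩
      · simp only [runLength, h, if_true, List.iterate, List.cons_append, ← h1]
      · simpa only [runLength, h, if_true, Function.iterate_succ_apply] using h2
    · exact ⟨x :: w, by simp [runLength, h], by simp [runLength, h]⟩

theorem foldr_push_iterate_of_lt {i : α} {t k : ℕ} {w : List α}
    (h : t + runLength s (s^[t] i) w < n) :
    (List.iterate s i t).foldr (push s n) (k, w) = (k, List.iterate s i t ++ w) := by
  induction t generalizing i with
  | zero => rfl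
  | succ t ih =>
    rw [Function.iterate_succ_apply] at h
    rw [List.iterate, List.foldr_cons, ih (by omega), push, if_pos, List.cons_append]
    simp only [runLength_iterate_append]
    omega

theorem foldr_push_iterate (hn : 0 < n) (hs : ∀ i, s^[n] i = i) (j : α) {k : ℕ} {w : List α}
    (hw : RunBounded s n w) :
    (List.iterate s j n).foldr (push s n) (k, w) = (k + 1, w) := by
  obtain ⟨w', hw', h0⟩ := exists_eq_iterate_append (s := s) j w
  have hlt := hw.runLength_lt hn j
  generalize hm : runLength s j w = m at *
  obtain ⟨t, rfl⟩ : ∃ t, n = m + (t + 1) := ⟨n - m - 1, by omega⟩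
  have hj : s^[t] (s (s^[m] j)) = j := by
    rw [← Function.iterate_succ_apply, ← Function.iterate_add_apply, add_comm (t.succ)]
    exact hs j
  have hrun : runLength s (s (s^[m] j)) (List.iterate s (s (s^[m] j)) t ++ w) = t + m := by
    rw [runLength_iterate_append, hj, hm]
  have hdrop : (List.iterate s (s (s^[m] j)) t ++ w).drop (m + (t + 1) - 1) = w' := by
    rw [hw', ← List.append_assoc]
    exact List.drop_left' (by simp; omega)
  rw [List.iterate_add, List.foldr_append, List.iterate, List.foldr_cons,
    foldr_push_iterate_of_lt (i := s (s^[m] j)) (by rw [hj, hm]; omega), push, if_neg (by simp only [hrun]; omega)]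
  simp only [hdrop]
  rw [foldr_push_iterate_of_lt (by rw [h0]; omega), ← hw']

end Runs

section Presentation

theorem iterate_finRotate {n : ℕ} (k : ℕ) : (finRotate n)^[k] = ⇑(finRotate n ^ k) :=
  (Equiv.Perm.coe_pow _ _).symm

theorem finRotate_iterate_zero {m k : ℕ} (hk : k < m + 1) :
    (finRotate (m + 1))^[k] 0 = ⟨k, hk⟩ := by
  induction k with
  | zero => rfl
  | succ k ih =>
    rw [Function.iterate_succ_apply', ih (by omega), finRotate_of_lt (by omega)]

theorem finRotate_iterate_val {m : ℕ} (i : Fin (m + 1)) : (finRotate (m + 1))^[i] 0 = i :=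
  finRotate_iterate_zero i.2

theorem finRotate_iterate_self {m : ℕ} (i : Fin (m + 1)) :
    (finRotate (m + 1))^[m + 1] i = i := by
  have h0 : (finRotate (m + 1))^[m + 1] 0 = 0 := by
    rw [Function.iterate_succ_apply', finRotate_iterate_zero (Nat.lt_succ_self m)]
    exact finRotate_last'
  conv_lhs => rw [← finRotate_iterate_val i]
  rw [← Function.iterate_add_apply, add_comm (m + 1), Function.iterate_add_apply, h0,
    finRotate_iterate_val]

theorem permWord_finRotate_pow (m k : ℕ) :
    permWord (m + 1) (finRotate (m + 1) ^ k) =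
      FreeMonoid.ofList (List.iterate (finRotate (m + 1)) ((finRotate (m + 1))^[k] 0) (m + 1)) := by
  have h : List.iterate (finRotate (m + 1)) ((finRotate (m + 1))^[k] 0) (m + 1) =
      (List.finRange (m + 1)).map (finRotate (m + 1) ^ k) := by
    refine List.ext_getElem (by simp) fun i h₁ h₂ => ?_
    simp only [List.length_iterate] at h₁
    rw [List.getElem_iterate, ← Function.iterate_add_apply, add_comm i,
      Function.iterate_add_apply, finRotate_iterate_zero h₁, iterate_finRotate]
    simp
  rw [h, permWord]
  generalize List.finRange (m + 1) = l
  induction l with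
  | nil => rfl
  | cons x l ih => rw [List.map_cons, List.prod_cons, ih]; rfl

namespace Scyc

variable {m : ℕ}

theorem induction_on {P : Scyc (m + 1) → Prop} (x : Scyc (m + 1)) (one : P 1)
    (agen_mul : ∀ i x, P x → P (agen i * x)) : P x := by
  refine Con.induction_on x fun w => ?_
  induction w using FreeMonoid.inductionOn' with
  | one => exact one
  | of_mul i w ih => exact agen_mul i _ ih

theorem exists_lift {M : Type*} [Monoid M] (g : Fin (m + 1) → M) (c : M)
    (hg : ∀ j, ((List.iterate (finRotate (m + 1)) j (m + 1)).map g).prod = c) :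
    ∃ f : Scyc (m + 1) →* M, ∀ i, f (agen i) = g i := by
  refine ⟨Con.lift _ (FreeMonoid.lift g) (Con.conGen_le.2 ?_), fun i => ?_⟩
  · rintro x y ⟨rfl, k, rfl⟩
    rw [Con.ker_rel, ← pow_zero (finRotate (m + 1)), permWord_finRotate_pow,
      permWord_finRotate_pow, FreeMonoid.lift_ofList, FreeMonoid.lift_ofList, hg, hg]
  · exact (Con.lift_mk' _ _).trans (FreeMonoid.lift_eval_of _ _)

theorem prod_map_agen (j : Fin (m + 1)) :
    ((List.iterate (finRotate (m + 1)) j (m + 1)).map agen).prod = zc (m + 1) := by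
  have key (k : ℕ) : ((List.iterate (finRotate (m + 1)) ((finRotate (m + 1))^[k] 0)
      (m + 1)).map agen).prod =
      (conGen (cycRel (m + 1))).mk' (permWord (m + 1) (finRotate (m + 1) ^ k)) := by
    rw [permWord_finRotate_pow, ← FreeMonoid.lift_ofList]
    exact DFunLike.congr_fun (FreeMonoid.hom_eq fun i => FreeMonoid.lift_eval_of _ _) _
  have hrel (k : ℕ) : (conGen (cycRel (m + 1))).mk' (permWord (m + 1) 1) =
      (conGen (cycRel (m + 1))).mk' (permWord (m + 1) (finRotate (m + 1) ^ k)) :=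
    (Con.eq _).2 (ConGen.Rel.of _ _ ⟨rfl, k, rfl⟩)
  rw [← finRotate_iterate_val j, key, ← hrel, permWord, map_list_prod, List.map_map]
  rfl

theorem agen_mul_zc (i : Fin (m + 1)) : agen i * zc (m + 1) = zc (m + 1) * agen i := by
  have h1 := prod_map_agen i
  have h2 := prod_map_agen (finRotate (m + 1) i)
  rw [List.iterate, List.map_cons, List.prod_cons] at h1
  rw [List.iterate_add, List.map_append, List.prod_append, ← Function.iterate_succ_apply,
    finRotate_iterate_self] at h2
  simp only [List.iterate, List.map_cons, List.map_nil, List.prod_singleton] at h2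
  rw [← h2, ← mul_assoc, h1, h2]

theorem commute_zc (x : Scyc (m + 1)) : Commute (zc (m + 1)) x := by
  induction x using induction_on with
  | one => exact Commute.one_right _
  | agen_mul i x ih => exact Commute.mul_right (agen_mul_zc i).symm ih

theorem zc_mul_cancel {x y : Scyc (m + 1)} (h : zc (m + 1) * x = zc (m + 1) * y) : x = y := by
  let s := finRotate (m + 1)
  let T := {p : ℕ × List (Fin (m + 1)) // RunBounded s (m + 1) p.2}
  let g : Fin (m + 1) → Function.End T := fun i p => ⟨push s (m + 1) i p.1, p.2.push i⟩
  let c : Function.End T := fun p => ⟨(p.1.1 + 1, p.1.2), p.2⟩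
  have hfold (l : List (Fin (m + 1))) (p : T) :
      ((l.map g).prod p).1 = l.foldr (push s (m + 1)) p.1 := by
    induction l with
    | nil => rfl
    | cons i l ih => rw [List.map_cons, List.prod_cons, List.foldr_cons, ← ih]; rfl
  have hg (j : Fin (m + 1)) : ((List.iterate s j (m + 1)).map g).prod = c := by
    funext p
    exact Subtype.ext ((hfold _ p).trans
      (foldr_push_iterate m.succ_pos finRotate_iterate_self j p.2))
  obtain ⟨f, hf⟩ := exists_lift g c hg
  have hfz : f (zc (m + 1)) = c := by
    rw [← prod_map_agen 0, map_list_prod, List.map_map, ← hg 0]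
    exact congrArg List.prod (List.map_congr_left fun i _ => hf i)
  let e : T := ⟨(0, []), trivial⟩
  let v : T → Scyc (m + 1) := fun p => zc (m + 1) ^ p.1.1 * (p.1.2.map agen).prod
  have hv (i : Fin (m + 1)) (p : T) : v (g i p) = agen i * v p := by
    obtain ⟨⟨k, w⟩, hw⟩ := p
    have hc : agen i * zc (m + 1) ^ k = zc (m + 1) ^ k * agen i :=
      ((commute_zc (agen i)).pow_left k).symm
    by_cases hlt : runLength s (s i) w + 1 < m + 1
    · simp only [v, g, push, hlt, if_true, List.map_cons, List.prod_cons, ← mul_assoc, hc]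
    · have hlen : runLength s (s i) w = m := by
        have := hw.runLength_lt m.succ_pos (s i)
        dsimp only at this
        omega
      obtain ⟨w', hw', -⟩ := exists_eq_iterate_append (s := s) (s i) w
      rw [hlen] at hw'
      simp only [v, g, push, hlt, if_false, ← mul_assoc, hc]
      rw [hw', List.drop_left' (by simp), pow_succ, ← prod_map_agen i]
      simp only [List.iterate, List.map_cons, List.prod_cons, List.map_append, List.prod_append,
        mul_assoc, s]
  have hvf (x : Scyc (m + 1)) : v (f x e) = x := by
    induction x using induction_on with
    | one => rw [map_one]; simp [v, e, Function.End.one_def]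
    | agen_mul i x ih => rw [map_mul, hf]; exact (hv i _).trans (congrArg _ ih)
  have h' : f (zc (m + 1)) * f x = f (zc (m + 1)) * f y := by rw [← map_mul, h, map_mul]
  rw [hfz] at h'
  have h1 : ((f x e).1.1 + 1, (f x e).1.2) = ((f y e).1.1 + 1, (f y e).1.2) :=
    congrArg Subtype.val (congrFun h' e)
  rw [Prod.mk.injEq, add_left_inj] at h1
  rw [← hvf x, ← hvf y, Subtype.ext (Prod.ext h1.1 h1.2)]

theorem zc_pow_mul_cancel {x y : Scyc (m + 1)} (k : ℕ)
    (h : zc (m + 1) ^ k * x = zc (m + 1) ^ k * y) : x = y := by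
  induction k with
  | zero => simpa using h
  | succ k ih =>
    rw [pow_succ', mul_assoc, mul_assoc] at h
    exact ih (zc_mul_cancel h)

/-- Two elements are related when they agree up to powers of the central element `zc`. -/
def zcCon (m : ℕ) : Con (Scyc (m + 1)) where
  r x y := ∃ k l : ℕ, zc (m + 1) ^ k * x = zc (m + 1) ^ l * y
  iseqv :=
    { refl := fun _ => ⟨0, 0, rfl⟩
      symm := fun ⟨k, l, h⟩ => ⟨l, k, h.symm⟩
      trans := fun {x y w} ⟨k, l, h⟩ ⟨k', l', h'⟩ => ⟨k' + k, l + l', by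
        rw [pow_add, mul_assoc, h, ← mul_assoc, ← pow_add, add_comm k', pow_add, mul_assoc, h',
          ← mul_assoc, ← pow_add]⟩ }
  mul' := fun {x y x' y'} ⟨k, l, h⟩ ⟨k', l', h'⟩ => ⟨k + k', l + l', by
    rw [pow_add, pow_add, ((commute_zc x).pow_left k').mul_mul_mul_comm, h, h',
      ((commute_zc y).pow_left l').mul_mul_mul_comm]⟩

theorem zcCon_zc : zcCon m (zc (m + 1)) 1 := ⟨0, 1, by simp⟩

/-- The map `Scyc (m + 1) → F_m` to the free group killing `zc`, given by `a_i ↦ x_i` for `i < m`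
and `a_m ↦ (x_0 ⋯ x_{m-1})⁻¹`; its fibres are contained in the classes of `zcCon`. -/
theorem exists_hom_freeGroup (m : ℕ) :
    ∃ φ : Scyc (m + 1) →* FreeGroup (Fin m), ∀ x y, φ x = φ y → zcCon m x y := by
  let s := finRotate (m + 1)
  let g : Fin (m + 1) → FreeGroup (Fin m) :=
    Fin.lastCases ((List.finRange m).map FreeGroup.of).prod⁻¹ FreeGroup.of
  have hiter : List.iterate s 0 (m + 1) = (List.finRange (m + 1)) :=
    List.ext_getElem (by simp) fun i h₁ h₂ => by
      rw [List.getElem_iterate, finRotate_iterate_zero (by simpa using h₁)]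
      simp
  have hprod0 {M : Type} [Monoid M] (f : Fin (m + 1) → M) :
      ((List.iterate s 0 (m + 1)).map f).prod =
        ((List.finRange m).map (f ∘ Fin.castSucc)).prod * f (Fin.last m) := by
    rw [hiter, List.finRange_succ_last]
    simp
  have hg0 : ((List.iterate s 0 (m + 1)).map g).prod = 1 := by
    rw [hprod0]
    simp only [g, Fin.lastCases_last]
    rw [mul_inv_eq_one]
    congr 2
    funext i
    simp
  have hstep (j : Fin (m + 1)) (h : ((List.iterate s j (m + 1)).map g).prod = 1) :
      ((List.iterate s (s j) (m + 1)).map g).prod = 1 := by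
    rw [List.iterate, List.map_cons, List.prod_cons] at h
    rw [List.iterate_add, List.map_append, List.prod_append, ← Function.iterate_succ_apply,
      finRotate_iterate_self]
    simpa [List.iterate] using mul_eq_one_comm.1 h
  have hg (j : Fin (m + 1)) : ((List.iterate s j (m + 1)).map g).prod = 1 := by
    rw [← finRotate_iterate_val j]
    induction (j : ℕ) with
    | zero => exact hg0
    | succ k ih => rw [Function.iterate_succ_apply']; exact hstep _ ih
  obtain ⟨φ, hφ⟩ := exists_lift g 1 hg
  let q : Scyc (m + 1) →* (zcCon m).Quotient := (zcCon m).mk'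
  have hqz : q (zc (m + 1)) = 1 := (Con.eq _).2 zcCon_zc
  have hunit (i : Fin (m + 1)) : IsUnit (q (agen i)) := by
    have h1 := prod_map_agen i
    rw [List.iterate, List.map_cons, List.prod_cons] at h1
    have h2 := agen_mul_zc i
    have h3 := prod_map_agen (finRotate (m + 1) i)
    rw [List.iterate_add, List.map_append, List.prod_append, ← Function.iterate_succ_apply,
      finRotate_iterate_self] at h3
    simp only [List.iterate, List.map_cons, List.map_nil, List.prod_singleton] at h3
    exact ⟨⟨_, _, by rw [← map_mul, h1, hqz], by rw [← map_mul, h3, hqz]⟩, rfl⟩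
  choose u hu using hunit
  let ψ : FreeGroup (Fin m) →* (zcCon m).Quotientˣ := FreeGroup.lift fun i => u i.castSucc
  have hψ : (Units.coeHom _).comp (ψ.comp φ) = q := by
    have hgen (i : Fin (m + 1)) : ψ (g i) = u i := by
      induction i using Fin.lastCases with
      | cast i => simp [g, ψ]
      | last =>
        simp only [g, Fin.lastCases_last, map_inv, map_list_prod, List.map_map]
        rw [inv_eq_iff_mul_eq_one]
        have hu1 : ((List.iterate s 0 (m + 1)).map u).prod = 1 := by
          apply Units.ext
          rw [← Units.coeHom_apply, map_list_prod, List.map_map, Units.val_one, ← hqz,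
            ← prod_map_agen 0, map_list_prod, List.map_map]
          exact congrArg List.prod (List.map_congr_left fun i _ => hu i)
        rw [hprod0] at hu1
        convert hu1 using 4
        funext i
        simp [ψ]
    refine MonoidHom.ext fun x => ?_
    induction x using induction_on with
    | one => simp
    | agen_mul i x ih => rw [map_mul, ih, map_mul]; simp [hφ, hgen, hu]
  refine ⟨φ, fun x y h => (Con.eq _).1 (?_ : q x = q y)⟩
  rw [← hψ]
  simp [h]

theorem exists_degree (m : ℕ) :
    ∃ d : Scyc (m + 1) →* Multiplicative ℕ, d (zc (m + 1)) = Multiplicative.ofAdd (m + 1) := by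
  have hg (j : Fin (m + 1)) : ((List.iterate (finRotate (m + 1)) j (m + 1)).map
      fun _ => Multiplicative.ofAdd 1).prod = Multiplicative.ofAdd (m + 1) := by
    rw [List.map_const', List.prod_replicate, List.length_iterate, ← ofAdd_nsmul]
    simp
  obtain ⟨d, hd⟩ := exists_lift _ _ hg
  refine ⟨d, ?_⟩
  rw [← prod_map_agen 0, map_list_prod, List.map_map, ← hg 0]
  exact congrArg List.prod (List.map_congr_left fun i _ => hd i)

theorem exists_injective_hom (m : ℕ) :
    ∃ f : Scyc (m + 1) →* FreeGroup (Fin m) × Multiplicative ℕ, Function.Injective f := by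
  obtain ⟨φ, hφ⟩ := exists_hom_freeGroup m
  obtain ⟨d, hd⟩ := exists_degree m
  refine ⟨φ.prod d, fun x y h => ?_⟩
  simp only [MonoidHom.prod_apply, Prod.mk.injEq] at h
  obtain ⟨k, l, hkl⟩ := hφ x y h.1
  have hdeg := congrArg (fun t => (d t).toAdd) hkl
  simp only [map_mul, map_pow, hd, h.2, toAdd_mul, toAdd_pow, toAdd_ofAdd, smul_eq_mul,
    add_left_inj] at hdeg
  obtain rfl := Nat.eq_of_mul_eq_mul_right m.succ_pos hdeg
  exact zc_pow_mul_cancel k hkl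

end Scyc

end Presentation

/-- `S_n` is a unique product monoid. -/
theorem unique_product (n : ℕ) (hn : 3 ≤ n) (A B : Finset (Scyc n))
    (hA : A.Nonempty) (hB : B.Nonempty) :
    ∃ a ∈ A, ∃ b ∈ B, ∀ a' ∈ A, ∀ b' ∈ B, a' * b' = a * b → a' = a ∧ b' = b := by
  obtain ⟨m, rfl⟩ : ∃ m, n = m + 1 := ⟨n - 1, by omega⟩
  obtain ⟨f, hf⟩ := Scyc.exists_injective_hom m
  have := IsFreeGroup.uniqueProds (FreeGroup (Fin m))
  have := UniqueProds.of_injective_mulHom f.toMulHom hf inferInstance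
  obtain ⟨a, ha, b, hb, h⟩ := UniqueProds.uniqueMul_of_nonempty hA hB
  exact ⟨a, ha, b, hb, fun a' ha' b' hb' => h ha' hb'⟩
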